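/- Let n ≥ 1, F := FreeGroup (Fin n), and let Φ : F ≃* F act trivially on H₁(F; ℤ/3). If c ∈ F and k ≥ 1 are such that Φ^k(c) is conjugate in F to c or to c⁻¹, then Φ(c) is conjugate to c in F. (Periodicity of the unoriented conjugacy class of c under an element of IA_n(ℤ/3) already forces the oriented conjugacy class of c to be fixed; this strengthening of Theorem 4.1 is established and used in Step 3 of its proof.) -/

import Mathlib

/-- An automorphism `Φ` of the free group acts trivially on `H₁(F; ℤ/3)`:
for every `x` there is `y` in the abelianization with
`Abelianization.of (Φ x) = Abelianization.of x * y ^ 3`. -/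
def ActsTriviallyOnH1Mod3 {n : ℕ}
    (Φ : FreeGroup (Fin n) ≃* FreeGroup (Fin n)) : Prop :=
  ∀ x : FreeGroup (Fin n), ∃ y : Abelianization (FreeGroup (Fin n)),
    Abelianization.of (Φ x) = Abelianization.of x * y ^ 3

section PeriodicSequences

theorem fwdDiff_iterate_add_period {a : ℕ → ℚ} {k : ℕ} (ha : ∀ i, a (i + k) = a i) (j i : ℕ) :
    (fwdDiff 1)^[j] a (i + k) = (fwdDiff 1)^[j] a i := by
  induction j generalizing i with
  | zero => exact ha i
  | succ j ih =>
    rw [Function.iterate_succ_apply', fwdDiff, fwdDiff, ih, add_right_comm, ih]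

theorem abs_fwdDiff_iterate_le {a : ℕ → ℚ} {C : ℚ} (ha : ∀ i, |a i| ≤ C) (j i : ℕ) :
    |(fwdDiff 1)^[j] a i| ≤ 2 ^ j * C := by
  induction j generalizing i with
  | zero => simpa using ha i
  | succ j ih =>
    rw [Function.iterate_succ_apply', fwdDiff]
    calc _ ≤ _ := abs_sub _ _
      _ ≤ 2 ^ j * C + 2 ^ j * C := add_le_add (ih _) (ih _)
      _ = _ := by ring

theorem apply_mod_of_periodic {a : ℕ → ℚ} {k : ℕ} (ha : ∀ i, a (i + k) = a i) (i : ℕ) :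
    a (i % k) = a i :=
  Function.Periodic.map_mod_nat ha i

theorem fwdDiff_eq_zero_of_iterate_eq_zero {a : ℕ → ℚ} {k : ℕ} (hk : 0 < k)
    (ha : ∀ i, a (i + k) = a i) (J : ℕ) (h : ∀ i, (fwdDiff 1)^[J + 1] a i = 0) (i : ℕ) :
    fwdDiff 1 a i = 0 := by
  induction J generalizing i with
  | zero => exact h i
  | succ J ih =>
    refine ih (fun i => ?_) i
    have hconst (m : ℕ) : (fwdDiff 1)^[J + 1] a (i + m) = (fwdDiff 1)^[J + 1] a i := by
      induction m with
      | zero => rfl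
      | succ m ihm =>
        have := h (i + m)
        rw [Function.iterate_succ_apply', fwdDiff, sub_eq_zero] at this
        rw [← add_assoc, this, ihm]
    have hlin (m : ℕ) : (fwdDiff 1)^[J] a (i + m) =
        (fwdDiff 1)^[J] a i + m * (fwdDiff 1)^[J + 1] a i := by
      induction m with
      | zero => simp
      | succ m ihm =>
        have := hconst m
        rw [Function.iterate_succ_apply', fwdDiff, sub_eq_iff_eq_add, ihm] at this
        rw [← add_assoc, this, Function.iterate_succ_apply']
        push_cast
        ring
    have := hlin k
    rw [fwdDiff_iterate_add_period ha] at this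
    have hk' : (k : ℚ) ≠ 0 := by positivity
    simpa [hk'] using this

/-- A periodic rational sequence whose `(j + 1)`-st differences are divisible by `3 ^ j`, up to
bounded denominators, is constant: these differences grow at most like `2 ^ j`. -/
theorem fwdDiff_eq_zero_of_periodic {a : ℕ → ℚ} {k : ℕ} (hk : 0 < k)
    (ha : ∀ i, a (i + k) = a i)
    (h : ∀ i, ∃ N : ℕ, 0 < N ∧ ∀ j, ∃ z : ℤ, N * (fwdDiff 1)^[j + 1] a i = 3 ^ j * z) (i : ℕ) :
    fwdDiff 1 a i = 0 := by
  obtain ⟨C, hC⟩ : ∃ C, ∀ i, |a i| ≤ C := by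
    refine ⟨∑ i ∈ Finset.range k, |a i|, fun i => ?_⟩
    rw [← apply_mod_of_periodic ha]
    exact Finset.single_le_sum (f := fun i => |a i|) (fun _ _ => abs_nonneg _)
      (Finset.mem_range.2 (Nat.mod_lt i hk))
  have key (i : ℕ) : ∃ J, ∀ j ≥ J, (fwdDiff 1)^[j + 1] a i = 0 := by
    obtain ⟨N, hN, hz⟩ := h i
    obtain ⟨J, hJ⟩ := pow_unbounded_of_one_lt (N * (2 * C)) (show (1 : ℚ) < 3 / 2 by norm_num)
    refine ⟨J, fun j hj => ?_⟩
    obtain ⟨z, hz⟩ := hz j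
    have hN' : (0 : ℚ) < N := by exact_mod_cast hN
    by_contra hne
    have hz0 : z ≠ 0 := by
      rintro rfl
      rw [Int.cast_zero, mul_zero] at hz
      exact (mul_ne_zero hN'.ne' hne) hz
    have hz1 : (1 : ℚ) ≤ |(z : ℚ)| := by exact_mod_cast Int.one_le_abs hz0
    have h1 : (3 : ℚ) ^ j ≤ N * (2 ^ (j + 1) * C) := by
      calc (3 : ℚ) ^ j ≤ 3 ^ j * |(z : ℚ)| := le_mul_of_one_le_right (by positivity) hz1
        _ = |N * (fwdDiff 1)^[j + 1] a i| := by
          rw [hz, abs_mul, abs_of_pos (show (0 : ℚ) < 3 ^ j by positivity)]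
        _ = N * |(fwdDiff 1)^[j + 1] a i| := by rw [abs_mul, abs_of_pos hN']
        _ ≤ _ := by gcongr; exact abs_fwdDiff_iterate_le hC _ _
    have h2 : (3 / 2 : ℚ) ^ j ≤ N * (2 * C) := by
      rw [div_pow, div_le_iff₀ (by positivity)]
      calc _ ≤ _ := h1
        _ = _ := by ring
    have h3 : (3 / 2 : ℚ) ^ J ≤ (3 / 2) ^ j := pow_le_pow_right₀ (by norm_num) hj
    linarith
  choose J hJ using key
  refine fwdDiff_eq_zero_of_iterate_eq_zero hk ha (∑ i ∈ Finset.range k, J i) (fun i => ?_) i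
  rw [← apply_mod_of_periodic (fwdDiff_iterate_add_period ha _) i]
  exact hJ _ _ (Finset.single_le_sum (fun _ _ => Nat.zero_le _)
    (Finset.mem_range.2 (Nat.mod_lt i hk)))

end PeriodicSequences

section PolynomialClassFunctions

variable {G : Type*} [Group G]

/-- The product of the elements `g - 1` of the group algebra, for `g` running through a list. -/
noncomputable def augProd (l : List G) : MonoidAlgebra ℚ G :=
  (l.map fun g => MonoidAlgebra.of ℚ G g - 1).prod

theorem augProd_append (l m : List G) : augProd (l ++ m) = augProd l * augProd m := by
  simp only [augProd, List.map_append, List.prod_append]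

theorem augProd_cons (g : G) (l : List G) :
    augProd (g :: l) = (MonoidAlgebra.of ℚ G g - 1) * augProd l := by
  simp only [augProd, List.map_cons, List.prod_cons]

/-- Linear extensions of the rational class functions on `G` which are polynomial of degree
less than `d`, i.e. vanish on the `d`-th power of the augmentation ideal. -/
def polyClass (G : Type*) [Group G] (d : ℕ) : Submodule ℚ (MonoidAlgebra ℚ G →ₗ[ℚ] ℚ) where
  carrier := {f | (∀ g h : G, IsConj g h → f (MonoidAlgebra.of ℚ G g) = f (MonoidAlgebra.of ℚ G h)) ∧
    ∀ l : List G, l.length = d → f (augProd l) = 0}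
  zero_mem' := ⟨fun _ _ _ => rfl, fun _ _ => rfl⟩
  add_mem' {a b} ha hb := ⟨fun g h hgh => by
      rw [LinearMap.add_apply, LinearMap.add_apply, ha.1 g h hgh, hb.1 g h hgh],
    fun l hl => by rw [LinearMap.add_apply, ha.2 l hl, hb.2 l hl, add_zero]⟩
  smul_mem' q a ha := ⟨fun g h hgh => by
      rw [LinearMap.smul_apply, LinearMap.smul_apply, ha.1 g h hgh],
    fun l hl => by rw [LinearMap.smul_apply, ha.2 l hl, smul_zero]⟩

/-- The top degree part of a polynomial function is a homomorphism in each slot. -/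
noncomputable def slotHom {f : MonoidAlgebra ℚ G →ₗ[ℚ] ℚ} {d : ℕ} (hf : f ∈ polyClass G (d + 1))
    (l m : List G) (hlm : l.length + m.length + 1 = d) : G →* Multiplicative ℚ where
  toFun g := .ofAdd (f (augProd (l ++ g :: m)))
  map_one' := by
    rw [augProd_append, augProd_cons, map_one, sub_self, zero_mul, mul_zero, map_zero, ofAdd_zero]
  map_mul' g h := by
    rw [← ofAdd_add, ← map_add]
    congr 1
    have h0 := hf.2 (l ++ g :: h :: m) (by simp; omega)
    rw [← sub_eq_zero, ← map_sub, ← h0]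
    congr 1
    simp only [augProd_append, augProd_cons, map_mul]
    noncomm_ring

theorem slotHom_apply {f : MonoidAlgebra ℚ G →ₗ[ℚ] ℚ} {d : ℕ} (hf : f ∈ polyClass G (d + 1))
    (l m : List G) (hlm : l.length + m.length + 1 = d) (g : G) :
    (slotHom hf l m hlm g).toAdd = f (augProd (l ++ g :: m)) :=
  rfl

theorem polyClass_apply_mem_of_generators {n d : ℕ}
    {f : MonoidAlgebra ℚ (FreeGroup (Fin n)) →ₗ[ℚ] ℚ} (hf : f ∈ polyClass _ (d + 1))
    (B : AddSubgroup ℚ)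
    (hB : ∀ t : List (Fin n), t.length = d → f (augProd (t.map FreeGroup.of)) ∈ B)
    (l : List (FreeGroup (Fin n))) (hl : l.length = d) : f (augProd l) ∈ B := by
  suffices H : ∀ (l : List (FreeGroup (Fin n))) (t : List (Fin n)), t.length + l.length = d →
      f (augProd (t.map FreeGroup.of ++ l)) ∈ B from H l [] (by simpa using hl)
  intro l
  induction l with
  | nil => intro t ht; simpa using hB t (by simpa using ht)
  | cons g l ih =>
    intro t ht
    have hlen : (t.map (FreeGroup.of (α := Fin n))).length + l.length + 1 = d := by
      simp at ht ⊢; omega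
    rw [← slotHom_apply hf _ _ hlen]
    clear ht
    induction g using FreeGroup.induction_on with
    | C1 => rw [map_one]; exact B.zero_mem
    | of i =>
      rw [slotHom_apply]
      have := ih (t ++ [i]) (by simp at hlen ⊢; omega)
      rwa [List.map_append, List.append_assoc] at this
    | inv_of i h => rw [map_inv]; exact B.neg_mem h
    | mul g h hg hh => rw [map_mul]; exact B.add_mem hg hh

/-- The action of an endomorphism of `G` on functions on the group algebra. -/
noncomputable def pullback (φ : G →* G) :
    (MonoidAlgebra ℚ G →ₗ[ℚ] ℚ) →ₗ[ℚ] (MonoidAlgebra ℚ G →ₗ[ℚ] ℚ) :=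
  LinearMap.lcomp ℚ ℚ
    (MonoidAlgebra.lift ℚ (MonoidAlgebra ℚ G) G ((MonoidAlgebra.of ℚ G).comp φ)).toLinearMap

theorem pullback_of (φ : G →* G) (f : MonoidAlgebra ℚ G →ₗ[ℚ] ℚ) (g : G) :
    pullback φ f (MonoidAlgebra.of ℚ G g) = f (MonoidAlgebra.of ℚ G (φ g)) := by
  simp [pullback]

theorem pullback_augProd (φ : G →* G) (f : MonoidAlgebra ℚ G →ₗ[ℚ] ℚ) (l : List G) :
    pullback φ f (augProd l) = f (augProd (l.map φ)) := by
  simp only [pullback, LinearMap.lcomp_apply, AlgHom.toLinearMap_apply, augProd, map_list_prod,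
    List.map_map]
  congr 3
  ext g : 1
  simp

theorem pullback_mem_polyClass (φ : G →* G) {f : MonoidAlgebra ℚ G →ₗ[ℚ] ℚ} {d : ℕ}
    (hf : f ∈ polyClass G d) : pullback φ f ∈ polyClass G d :=
  ⟨fun g h hgh => by
    rw [pullback_of, pullback_of]
    exact hf.1 _ _ (φ.map_isConj hgh),
  fun l hl => by
    rw [pullback_augProd]
    exact hf.2 _ (by simpa using hl)⟩

end PolynomialClassFunctions

section Dynamics

variable {n : ℕ} {Φ : FreeGroup (Fin n) ≃* FreeGroup (Fin n)}

theorem ActsTriviallyOnH1Mod3.exists_map_eq (hΦ : ActsTriviallyOnH1Mod3 Φ)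
    (g : FreeGroup (Fin n)) : ∃ w, ∀ h : FreeGroup (Fin n) →* Multiplicative ℚ,
      h (Φ g) = h g * h w ^ 3 := by
  obtain ⟨y, hy⟩ := hΦ g
  obtain ⟨w, rfl⟩ : ∃ w, Abelianization.of w = y := QuotientGroup.mk_surjective y
  refine ⟨w, fun h => ?_⟩
  have := congrArg (Abelianization.lift h) hy
  simpa only [map_mul, map_pow, Abelianization.lift_apply_of] using this

theorem ActsTriviallyOnH1Mod3.exists_sub_eq (hΦ : ActsTriviallyOnH1Mod3 Φ) {d : ℕ}
    {f : MonoidAlgebra ℚ (FreeGroup (Fin n)) →ₗ[ℚ] ℚ} (hf : f ∈ polyClass _ (d + 1))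
    {B : AddSubgroup ℚ} (hB : ∀ l : List (FreeGroup (Fin n)), l.length = d → f (augProd l) ∈ B)
    (l : List (FreeGroup (Fin n))) (hl : l.length = d) :
    ∃ b ∈ B, f (augProd (l.map Φ)) - f (augProd l) = 3 * b := by
  suffices H : ∀ l m : List (FreeGroup (Fin n)), m.length + l.length = d →
      ∃ b ∈ B, f (augProd (m ++ l.map Φ)) - f (augProd (m ++ l)) = 3 * b from
    H l [] (by simpa using hl)
  intro l
  induction l with
  | nil => intro m _; exact ⟨0, B.zero_mem, by simp⟩
  | cons g l ih =>
    intro m hm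
    obtain ⟨b, hb, h1⟩ := ih (m ++ [Φ g]) (by simp at hm ⊢; omega)
    obtain ⟨w, hw⟩ := hΦ.exists_map_eq g
    have hlen : m.length + l.length + 1 = d := by simp at hm; omega
    have h2 := congrArg Multiplicative.toAdd (hw (slotHom hf m l hlen))
    rw [toAdd_mul, toAdd_pow, slotHom_apply, slotHom_apply, slotHom_apply] at h2
    refine ⟨b + f (augProd (m ++ w :: l)),
      B.add_mem hb (hB _ (by simp; omega)), ?_⟩
    simp only [List.append_assoc, List.singleton_append, List.map_cons, nsmul_eq_mul] at h1 h2 ⊢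
    rw [h2] at h1
    push_cast at h1
    linarith

/-- The operator `(Φ - 1) / 3` on functions. -/
noncomputable def thirdDiff (Φ : FreeGroup (Fin n) ≃* FreeGroup (Fin n)) :
    (MonoidAlgebra ℚ (FreeGroup (Fin n)) →ₗ[ℚ] ℚ) →ₗ[ℚ]
      (MonoidAlgebra ℚ (FreeGroup (Fin n)) →ₗ[ℚ] ℚ) :=
  (3⁻¹ : ℚ) • (pullback (Φ : FreeGroup (Fin n) →* FreeGroup (Fin n)) - LinearMap.id)

theorem thirdDiff_apply (f : MonoidAlgebra ℚ (FreeGroup (Fin n)) →ₗ[ℚ] ℚ) (x) :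
    thirdDiff Φ f x = 3⁻¹ * (pullback (Φ : FreeGroup (Fin n) →* FreeGroup (Fin n)) f x - f x) :=
  rfl

theorem thirdDiff_mem_polyClass {d : ℕ} {f : MonoidAlgebra ℚ (FreeGroup (Fin n)) →ₗ[ℚ] ℚ}
    (hf : f ∈ polyClass _ d) : thirdDiff Φ f ∈ polyClass _ d :=
  Submodule.smul_mem _ _ (Submodule.sub_mem _ (pullback_mem_polyClass _ hf) hf)

theorem ActsTriviallyOnH1Mod3.thirdDiff_augProd_mem (hΦ : ActsTriviallyOnH1Mod3 Φ) {d : ℕ}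
    {f : MonoidAlgebra ℚ (FreeGroup (Fin n)) →ₗ[ℚ] ℚ} (hf : f ∈ polyClass _ (d + 1))
    {B : AddSubgroup ℚ} (hB : ∀ l : List (FreeGroup (Fin n)), l.length = d → f (augProd l) ∈ B)
    (l : List (FreeGroup (Fin n))) (hl : l.length = d) : thirdDiff Φ f (augProd l) ∈ B := by
  obtain ⟨b, hb, h⟩ := hΦ.exists_sub_eq hf hB l hl
  rw [thirdDiff_apply, pullback_augProd]
  simpa [h] using hb

/-- The values of a function along the `Φ`-orbit of `c`. -/
noncomputable def orbitSeq (Φ : FreeGroup (Fin n) ≃* FreeGroup (Fin n)) (c : FreeGroup (Fin n))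
    (f : MonoidAlgebra ℚ (FreeGroup (Fin n)) →ₗ[ℚ] ℚ) (i : ℕ) : ℚ :=
  f (MonoidAlgebra.of ℚ _ ((Φ ^ i) c))

theorem fwdDiff_orbitSeq (c : FreeGroup (Fin n))
    (f : MonoidAlgebra ℚ (FreeGroup (Fin n)) →ₗ[ℚ] ℚ) :
    fwdDiff 1 (orbitSeq Φ c f) = (3 : ℚ) • orbitSeq Φ c (thirdDiff Φ f) := by
  ext i
  simp only [fwdDiff, orbitSeq, Pi.smul_apply, thirdDiff_apply, pullback_of, smul_eq_mul,
    pow_succ', MulAut.mul_apply, MonoidHom.coe_coe]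
  ring

theorem fwdDiff_iterate_orbitSeq (c : FreeGroup (Fin n))
    (f : MonoidAlgebra ℚ (FreeGroup (Fin n)) →ₗ[ℚ] ℚ) (j : ℕ) :
    (fwdDiff 1)^[j] (orbitSeq Φ c f) = (3 ^ j : ℚ) • orbitSeq Φ c ((thirdDiff Φ)^[j] f) := by
  induction j generalizing f with
  | zero => simp
  | succ j ih =>
    rw [Function.iterate_succ_apply, fwdDiff_orbitSeq, fwdDiff_iter_const_smul, ih, smul_smul,
      Function.iterate_succ_apply, pow_succ']

theorem exists_common_denominator {ι : Type*} [Fintype ι] (q : ι → ℚ) :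
    ∃ N : ℕ, 0 < N ∧ ∀ i, ∃ z : ℤ, N * q i = z := by
  refine ⟨∏ i, (q i).den, Finset.prod_pos fun i _ => (q i).den_pos, fun i => ?_⟩
  obtain ⟨m, hm⟩ := Finset.dvd_prod_of_mem (fun i => (q i).den) (Finset.mem_univ i)
  refine ⟨m * (q i).num, ?_⟩
  rw [hm]
  push_cast
  rw [mul_comm ((q i).den : ℚ), mul_assoc, Rat.den_mul_eq_num]

theorem ActsTriviallyOnH1Mod3.polyClass_apply_orbit_succ (hΦ : ActsTriviallyOnH1Mod3 Φ)
    {c : FreeGroup (Fin n)} {k : ℕ} (hk : 0 < k) (hc : IsConj ((Φ ^ k) c) c) {d : ℕ} (hd : 1 ≤ d)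
    {f : MonoidAlgebra ℚ (FreeGroup (Fin n)) →ₗ[ℚ] ℚ} (hf : f ∈ polyClass _ d) (i : ℕ) :
    fwdDiff 1 (orbitSeq Φ c f) i = 0 := by
  induction d, hd using Nat.le_induction generalizing f i with
  | base =>
    have h (g : FreeGroup (Fin n)) : f (MonoidAlgebra.of ℚ _ g) = f 1 := by
      have := hf.2 [g] rfl
      rwa [augProd_cons, augProd, List.map_nil, List.prod_nil, mul_one, map_sub, sub_eq_zero] at this
    rw [fwdDiff, orbitSeq, orbitSeq, h, h, sub_self]
  | succ d hd ih =>
    have hper (i : ℕ) : orbitSeq Φ c f (i + k) = orbitSeq Φ c f i := by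
      refine hf.1 _ _ ?_
      rw [pow_add, MulAut.mul_apply]
      exact (Φ ^ i : FreeGroup (Fin n) ≃* FreeGroup (Fin n)).toMonoidHom.map_isConj hc
    refine fwdDiff_eq_zero_of_periodic hk hper (fun i => ?_) i
    let P := polyClass (FreeGroup (Fin n)) (d + 1)
    let L (t : Fin d → Fin n) : P →ₗ[ℚ] ℚ :=
      (LinearMap.applyₗ (augProd ((List.ofFn t).map FreeGroup.of))).comp P.subtype
    let K : P →ₗ[ℚ] ℚ :=
      (LinearMap.applyₗ (MonoidAlgebra.of ℚ _ ((Φ ^ (i + 1)) c) - MonoidAlgebra.of ℚ _ ((Φ ^ i) c)))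
        |>.comp P.subtype
    have hL (g : P) (t) : L t g = g.1 (augProd ((List.ofFn t).map FreeGroup.of)) := rfl
    have hK (g : P) : K g = fwdDiff 1 (orbitSeq Φ c g.1) i := map_sub g.1 _ _
    have hgen (B : AddSubgroup ℚ) (g : P) (hg : ∀ t, L t g ∈ B) (l : List (FreeGroup (Fin n)))
        (hl : l.length = d) : g.1 (augProd l) ∈ B := by
      refine polyClass_apply_mem_of_generators g.2 B (fun t ht => ?_) l hl
      subst ht
      simpa [hL] using hg t.get
    have hKL : K ∈ Submodule.span ℚ (Set.range L) := by
      refine mem_span_of_iInf_ker_le_ker fun g hg => ?_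
      rw [Submodule.mem_iInf] at hg
      rw [LinearMap.mem_ker, hK]
      refine ih ⟨g.2.1, fun l hl => ?_⟩ i
      exact AddSubgroup.mem_bot.1 (hgen ⊥ g (fun t => AddSubgroup.mem_bot.2 (hg t)) l hl)
    obtain ⟨q, hq⟩ := (Submodule.mem_span_range_iff_exists_fun ℚ).1 hKL
    obtain ⟨N, hN, hNq⟩ := exists_common_denominator q
    obtain ⟨M, hM, hMf⟩ := exists_common_denominator fun t => L t ⟨f, hf⟩
    let B : AddSubgroup ℚ := (Int.castAddHom ℚ).range.comap (AddMonoidHom.mulLeft (M : ℚ))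
    have hBmem (x : ℚ) : x ∈ B ↔ ∃ z : ℤ, (z : ℚ) = M * x := Iff.rfl
    have hiter (j : ℕ) : (thirdDiff Φ)^[j] f ∈ P ∧ ∀ l : List (FreeGroup (Fin n)),
        l.length = d → (thirdDiff Φ)^[j] f (augProd l) ∈ B := by
      induction j with
      | zero =>
        refine ⟨hf, fun l hl => hgen B ⟨f, hf⟩ (fun t => ?_) l hl⟩
        obtain ⟨z, hz⟩ := hMf t
        exact (hBmem _).2 ⟨z, hz.symm⟩
      | succ j ihj =>
        rw [Function.iterate_succ_apply']
        exact ⟨thirdDiff_mem_polyClass ihj.1, hΦ.thirdDiff_augProd_mem ihj.1 ihj.2⟩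
    refine ⟨M * N, Nat.mul_pos hM hN, fun j => ?_⟩
    have h1 (t : Fin d → Fin n) :
        ∃ z : ℤ, (z : ℚ) = (M * N : ℕ) * (q t * L t ⟨_, (hiter j).1⟩) := by
      obtain ⟨z, hz⟩ := (hBmem _).1 ((hiter j).2 ((List.ofFn t).map FreeGroup.of) (by simp))
      obtain ⟨y, hy⟩ := hNq t
      refine ⟨y * z, ?_⟩
      rw [Int.cast_mul, hz, ← hy, hL]
      push_cast
      ring
    choose z hz using h1
    refine ⟨∑ t, z t, ?_⟩
    have h2 : K ⟨_, (hiter j).1⟩ = ∑ t, q t * L t ⟨_, (hiter j).1⟩ := by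
      rw [← hq, LinearMap.sum_apply]
      rfl
    rw [hK] at h2
    rw [Function.iterate_succ_apply', fwdDiff_iterate_orbitSeq, fwdDiff_const_smul, Pi.smul_apply,
      h2, Int.cast_sum, Finset.sum_congr rfl fun t _ => hz t, ← Finset.mul_sum, smul_eq_mul]
    ring

end Dynamics

section LaurentPairing

open LaurentPolynomial

/-- The functional on Laurent polynomials sending `T k` to the binomial coefficient of
`k + s` over `m`. -/
noncomputable def choosePairing (s : ℤ) (m : ℕ) : ℚ[T;T⁻¹] →ₗ[ℚ] ℚ :=
  (Finsupp.linearCombination ℚ fun k : ℤ => ((Ring.choose (k + s) m : ℤ) : ℚ)) ∘ₗ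
    (AddMonoidAlgebra.coeffLinearEquiv ℚ).toLinearMap

theorem choosePairing_T (s : ℤ) (m : ℕ) (k : ℤ) :
    choosePairing s m (T k) = (Ring.choose (k + s) m : ℤ) := by
  change Finsupp.linearCombination ℚ _ (Finsupp.single k (1 : ℚ)) = _
  rw [Finsupp.linearCombination_single, one_smul]

theorem laurent_linearMap_ext {f g : ℚ[T;T⁻¹] →ₗ[ℚ] ℚ} (h : ∀ k, f (T k) = g (T k)) : f = g := by
  refine LinearMap.ext fun x => ?_
  induction x using LaurentPolynomial.induction_on' with
  | add p q hp hq => rw [map_add, map_add, hp, hq]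
  | C_mul_T k a => rw [← smul_eq_C_mul, map_smul, map_smul, h]

theorem choosePairing_zero_mul (s : ℤ) (x : ℚ[T;T⁻¹]) :
    choosePairing s 0 ((T 1 - 1) * x) = 0 := by
  have : (choosePairing s 0).comp (LinearMap.mulLeft ℚ (T 1 - 1)) = 0 :=
    laurent_linearMap_ext fun k => by
      rw [LinearMap.comp_apply, LinearMap.mulLeft_apply, sub_mul, one_mul, ← T_add, map_sub,
        choosePairing_T, choosePairing_T, Ring.choose_zero_right, Ring.choose_zero_right, sub_self,
        LinearMap.zero_apply]
  exact congrArg (fun f => f x) this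

theorem choosePairing_succ_mul (s : ℤ) (m : ℕ) (x : ℚ[T;T⁻¹]) :
    choosePairing s (m + 1) ((T 1 - 1) * x) = choosePairing s m x := by
  have : (choosePairing s (m + 1)).comp (LinearMap.mulLeft ℚ (T 1 - 1)) = choosePairing s m :=
    laurent_linearMap_ext fun k => by
      rw [LinearMap.comp_apply, LinearMap.mulLeft_apply, sub_mul, one_mul, ← T_add, map_sub,
        choosePairing_T, choosePairing_T, choosePairing_T, add_comm 1 k, add_right_comm,
        Ring.choose_succ_succ]
      push_cast
      ring
  exact congrArg (fun f => f x) this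

theorem choosePairing_pow_mul (s : ℤ) (m : ℕ) (x : ℚ[T;T⁻¹]) :
    choosePairing s m ((T 1 - 1) ^ (m + 1) * x) = 0 := by
  induction m with
  | zero => rw [zero_add, pow_one, choosePairing_zero_mul]
  | succ m ih => rw [pow_succ', mul_assoc, choosePairing_succ_mul, ih]

theorem choosePairing_T_of_abs_le {N : ℕ} {k : ℤ} (hk : |k| ≤ N) :
    choosePairing N (2 * N) (T k) = if k = N then 1 else 0 := by
  rw [abs_le] at hk
  obtain ⟨j, hj⟩ := Int.eq_ofNat_of_zero_le (show 0 ≤ k + N by omega)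
  rw [choosePairing_T, hj]
  simp only [Ring.choose_natCast, Int.cast_natCast]
  split_ifs with h
  · rw [show j = 2 * N by omega, Nat.choose_self]
    rfl
  · rw [Nat.choose_eq_zero_of_lt (by omega)]
    rfl

theorem T_one_sub_one_dvd (k : ℤ) : (T 1 - 1 : ℚ[T;T⁻¹]) ∣ T k - 1 := by
  have hn (m : ℕ) : (T 1 - 1 : ℚ[T;T⁻¹]) ∣ T m - 1 := by
    simpa [T_pow] using sub_one_dvd_pow_sub_one (T 1 : ℚ[T;T⁻¹]) m
  obtain ⟨m, rfl | rfl⟩ := k.eq_nat_or_neg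
  · exact hn m
  · have : (T (-m) - 1 : ℚ[T;T⁻¹]) = -T (-m) * (T m - 1) := by
      rw [mul_sub, neg_mul, ← T_add, neg_add_cancel, T_zero]
      ring
    rw [this]
    exact (hn m).mul_left _

theorem choosePairing_prod_T_sub_one {ι : Type*} [Fintype ι] {N : ℕ} {x y : ι → ℤ}
    (hx : ∀ i, x i ≠ 0) (hxN : ∑ i, x i ^ 2 = N) (hyN : ∑ i, y i ^ 2 ≤ N) :
    choosePairing N (2 * N) (∏ i, (T (x i * y i) - 1)) = if x = y then 1 else 0 := by
  classical
  have hsub (s : Finset ι) (z : ι → ℤ) : ∑ i ∈ s, z i ^ 2 ≤ ∑ i, z i ^ 2 :=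
    Finset.sum_le_sum_of_subset_of_nonneg (Finset.subset_univ s) fun i _ _ => sq_nonneg _
  have hid (s : Finset ι) : ∑ i ∈ s, (x i - y i) ^ 2 + 2 * ∑ i ∈ s, x i * y i =
      ∑ i ∈ s, x i ^ 2 + ∑ i ∈ s, y i ^ 2 := by
    rw [Finset.mul_sum, ← Finset.sum_add_distrib, ← Finset.sum_add_distrib]
    exact Finset.sum_congr rfl fun i _ => by ring
  have hid' (s : Finset ι) : ∑ i ∈ s, (x i + y i) ^ 2 - 2 * ∑ i ∈ s, x i * y i =
      ∑ i ∈ s, x i ^ 2 + ∑ i ∈ s, y i ^ 2 := by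
    rw [Finset.mul_sum, ← Finset.sum_sub_distrib, ← Finset.sum_add_distrib]
    exact Finset.sum_congr rfl fun i _ => by ring
  have habs (s : Finset ι) : |∑ i ∈ s, x i * y i| ≤ N := by
    have h1 : 0 ≤ ∑ i ∈ s, (x i - y i) ^ 2 := Finset.sum_nonneg fun i _ => sq_nonneg _
    have h2 : 0 ≤ ∑ i ∈ s, (x i + y i) ^ 2 := Finset.sum_nonneg fun i _ => sq_nonneg _
    rw [abs_le]
    constructor <;> linarith [hid s, hid' s, hsub s x, hsub s y]
  have heq (s : Finset ι) : (∑ i ∈ s, x i * y i = N) ↔ s = Finset.univ ∧ x = y := by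
    constructor
    · intro h
      have h1 : 0 ≤ ∑ i ∈ s, (x i - y i) ^ 2 := Finset.sum_nonneg fun i _ => sq_nonneg _
      have hs : s = Finset.univ := by
        by_contra hne
        obtain ⟨i, hi⟩ : ∃ i, i ∉ s := by
          by_contra! hall
          exact hne (Finset.eq_univ_iff_forall.2 hall)
        have := Finset.sum_lt_sum_of_subset (f := fun i => x i ^ 2) (Finset.subset_univ s)
          (Finset.mem_univ i) hi (by have := hx i; positivity) fun j _ _ => sq_nonneg _
        linarith [hid s, hsub s y]
      refine ⟨hs, ?_⟩
      subst hs
      have h2 : ∑ i, (x i - y i) ^ 2 = 0 := by linarith [hid Finset.univ]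
      ext i
      have := (Finset.sum_eq_zero_iff_of_nonneg fun i _ => sq_nonneg _).1 h2 i (Finset.mem_univ i)
      exact sub_eq_zero.1 (pow_eq_zero_iff two_ne_zero |>.1 this)
    · rintro ⟨rfl, rfl⟩
      rw [← hxN]
      exact Finset.sum_congr rfl fun i _ => by ring
  have hT (s : Finset ι) : ∏ i ∈ s, (T (x i * y i) : ℚ[T;T⁻¹]) = T (∑ i ∈ s, x i * y i) := by
    induction s using Finset.induction_on with
    | empty => simp
    | insert i s hi ih => rw [Finset.prod_insert hi, Finset.sum_insert hi, ih, T_add]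
  simp only [sub_eq_add_neg, Finset.prod_add, map_sum, hT, Finset.prod_const]
  have hterm (s : Finset ι) : choosePairing N (2 * N)
      (T (∑ i ∈ s, x i * y i) * (-1) ^ (Finset.univ \ s).card) =
      if s = Finset.univ ∧ x = y then 1 else 0 := by
    have hsign : T (∑ i ∈ s, x i * y i) * (-1) ^ (Finset.univ \ s).card =
        ((-1 : ℚ) ^ (Finset.univ \ s).card) • (T (∑ i ∈ s, x i * y i) : ℚ[T;T⁻¹]) := by
      rw [smul_eq_C_mul, map_pow, map_neg, map_one, mul_comm]
    rw [hsign, map_smul, choosePairing_T_of_abs_le (habs s)]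
    by_cases h : s = Finset.univ ∧ x = y
    · rw [if_pos ((heq s).2 h), if_pos h, h.1]
      simp
    · rw [if_neg (mt (heq s).1 h), if_neg h, smul_zero]
  simp only [hterm]
  by_cases hxy : x = y <;> simp [hxy]

end LaurentPairing

section CyclicRepresentation

open LaurentPolynomial Matrix

theorem linear_mul_linear {R : Type*} [Ring R] (a b a' b' : R) :
    (Polynomial.C a + Polynomial.C b * Polynomial.X) *
      (Polynomial.C a' + Polynomial.C b' * Polynomial.X) =
    Polynomial.C (a * a') + Polynomial.C (a * b' + b * a') * Polynomial.X +
      Polynomial.C (b * b') * Polynomial.X ^ 2 := by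
  have h (x : R) (p : Polynomial R) :
      Polynomial.X * (Polynomial.C x * p) = Polynomial.C x * (Polynomial.X * p) := by
    rw [← mul_assoc, Polynomial.X_mul_C, mul_assoc]
  simp only [map_add, map_mul, add_mul, mul_add, mul_assoc, Polynomial.X_mul_C, h, pow_two]
  abel

variable {r : ℕ} {A : Type*} [CommRing A]

/-- The matrix with entries `w j` in the positions `(j, j + 1)`, indices being cyclic. -/
def shiftMatrix (w : ZMod r → A) : Matrix (ZMod r) (ZMod r) A :=
  Matrix.of fun j j' => if j' = j + 1 then w j else 0

theorem shiftMatrix_apply (w : ZMod r → A) (j j' : ZMod r) :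
    shiftMatrix w j j' = if j' = j + 1 then w j else 0 :=
  rfl

variable [NeZero r]

theorem diagonal_mul_shiftMatrix (v w : ZMod r → A) :
    diagonal v * shiftMatrix w = shiftMatrix (v * w) := by
  ext j j'
  simp [shiftMatrix_apply, diagonal_mul]

theorem shiftMatrix_mul_diagonal (v w : ZMod r → A) :
    shiftMatrix w * diagonal v = shiftMatrix fun j => w j * v (j + 1) := by
  ext j j'
  rw [mul_diagonal, shiftMatrix_apply, shiftMatrix_apply]
  split_ifs with h
  · rw [h]
  · rw [zero_mul]

theorem shiftMatrix_mul_apply (w : ZMod r → A) (P : Matrix (ZMod r) (ZMod r) A) (j j' : ZMod r) :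
    (shiftMatrix w * P) j j' = w j * P (j + 1) j' := by
  simp [mul_apply, shiftMatrix_apply]

theorem shiftMatrix_list_prod_apply (l : List (ZMod r → A)) (j j' : ZMod r) :
    (l.map shiftMatrix).prod j j' =
      if j' = j + l.length then ∏ k : Fin l.length, l[k] (j + (k : ℕ)) else 0 := by
  induction l generalizing j with
  | nil => simp [one_apply, eq_comm]
  | cons w l ih =>
    have hprod : (∏ k : Fin (w :: l).length, (w :: l)[k] (j + (k : ℕ))) =
        w j * ∏ k : Fin l.length, l[k] (j + 1 + (k : ℕ)) :=
      (Fin.prod_univ_succ (n := l.length) _).trans (by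
        congr 1
        · change w (j + (0 : ℕ)) = w j
          rw [Nat.cast_zero, add_zero]
        · refine Finset.prod_congr rfl fun k _ => ?_
          change l[k] (j + (k + 1 : ℕ)) = _
          rw [Nat.cast_succ, add_assoc, add_comm 1])
    have hj : j + 1 + (l.length : ZMod r) = j + ((w :: l).length : ℕ) := by
      rw [List.length_cons]
      push_cast
      ring
    rw [List.map_cons, List.prod_cons, shiftMatrix_mul_apply, ih, hprod, hj, mul_ite, mul_zero]

theorem trace_shiftMatrix_list_prod (l : List (ZMod r → A)) (hl : l.length = r) :
    (l.map shiftMatrix).prod.trace = ∑ j, ∏ k : Fin l.length, l[k] (j + (k : ℕ)) := by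
  refine Finset.sum_congr rfl fun j _ => ?_
  rw [diag_apply, shiftMatrix_list_prod_apply, if_pos (by simp [hl])]

/-- The image of `m : ℤ` under a one-parameter group of bidiagonal cyclic matrices; the formal
variable counts steps off the diagonal. -/
noncomputable def cyclicElem (s : ZMod r → Prop) [DecidablePred s] (e : ZMod r → ℤ) (m : ℤ) :
    Polynomial (Matrix (ZMod r) (ZMod r) ℚ[T;T⁻¹]) :=
  Polynomial.C (diagonal fun j => if s j then T (e j * m) else 1) +
    Polynomial.C (shiftMatrix fun j => if s j then T (e j * m) - 1 else 0) * Polynomial.X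

variable (s : ZMod r → Prop) [DecidablePred s] (e : ZMod r → ℤ)

theorem cyclicElem_zero : cyclicElem s e 0 = 1 := by
  have h : (shiftMatrix fun _ => 0 : Matrix (ZMod r) (ZMod r) ℚ[T;T⁻¹]) = 0 := by
    ext j j'
    simp [shiftMatrix_apply]
  simp [cyclicElem, h]

theorem cyclicElem_add (hs : ∀ j, s j → ¬ s (j + 1)) (m m' : ℤ) :
    cyclicElem s e (m + m') = cyclicElem s e m * cyclicElem s e m' := by
  have hEE : shiftMatrix (fun j => if s j then T (e j * m) - 1 else (0 : ℚ[T;T⁻¹])) *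
      shiftMatrix (fun j => if s j then T (e j * m') - 1 else 0) = 0 := by
    ext j j' : 1
    rw [shiftMatrix_mul_apply, shiftMatrix_apply]
    by_cases h : s j <;> simp [h, hs j]
  rw [cyclicElem, cyclicElem, cyclicElem, linear_mul_linear, hEE, map_zero, zero_mul, add_zero,
    diagonal_mul_diagonal, diagonal_mul_shiftMatrix, shiftMatrix_mul_diagonal]
  congr 3
  · ext j : 1
    by_cases h : s j <;> simp only [h, if_true, if_false, mul_add, T_add, mul_one]
  · ext j j' : 1
    rw [Matrix.add_apply]
    simp only [shiftMatrix_apply, Pi.mul_apply]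
    by_cases h : s j
    · simp only [h, hs j h, if_true, if_false, mul_add, T_add]
      split_ifs <;> ring
    · simp [h]

theorem natDegree_cyclicElem_le (m : ℤ) : (cyclicElem s e m).natDegree ≤ 1 := by
  rw [cyclicElem, add_comm]
  exact Polynomial.natDegree_linear_le

theorem coeff_one_cyclicElem (m : ℤ) : (cyclicElem s e m).coeff 1 =
    shiftMatrix fun j => if s j then T (e j * m) - 1 else 0 := by
  simp [cyclicElem, Polynomial.coeff_C]

theorem exists_cyclicElem_sub_one_eq (m : ℤ) :
    ∃ b, cyclicElem s e m - 1 = (T 1 - 1 : ℚ[T;T⁻¹]) • b := by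
  choose q hq using T_one_sub_one_dvd
  refine ⟨Polynomial.C (diagonal fun j => if s j then q (e j * m) else 0) +
    Polynomial.C (shiftMatrix fun j => if s j then q (e j * m) else 0) * Polynomial.X, ?_⟩
  rw [cyclicElem, smul_add, ← smul_mul_assoc, Polynomial.smul_C, Polynomial.smul_C,
    add_sub_right_comm, ← Polynomial.C_1, ← Polynomial.C_sub]
  congr 3
  · rw [← diagonal_one, diagonal_sub, ← diagonal_smul]
    congr 1
    ext j : 1
    by_cases h : s j <;> simp [h, ← hq]
  · ext j j' : 1
    by_cases h : s j <;> simp [h, shiftMatrix_apply, ← hq]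

end CyclicRepresentation

section CyclicFunctional

open LaurentPolynomial Matrix

variable {α : Type*} [DecidableEq α] {r : ℕ} [NeZero r]

/-- The representation of the free group sending the powers of each generator `i` to the
one-parameter group attached to the indices `j` with `ι j = i`. -/
noncomputable def cyclicRep (ι : ZMod r → α) (e : ZMod r → ℤ) (hι : ∀ j, ι j ≠ ι (j + 1)) :
    FreeGroup α →* Polynomial (Matrix (ZMod r) (ZMod r) ℚ[T;T⁻¹]) :=
  (Units.coeHom _).comp <| FreeGroup.lift fun i =>
    MonoidHom.toHomUnits
      { toFun := fun m : Multiplicative ℤ => cyclicElem (fun j => ι j = i) e m.toAdd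
        map_one' := cyclicElem_zero _ _
        map_mul' := fun m m' => cyclicElem_add _ _ (by rintro j rfl h; exact hι j h.symm) _ _ }
      (Multiplicative.ofAdd 1)

variable {ι : ZMod r → α} (e : ZMod r → ℤ) (hι : ∀ j, ι j ≠ ι (j + 1))

theorem cyclicRep_of_zpow (i : α) (m : ℤ) :
    cyclicRep ι e hι (FreeGroup.of i ^ m) = cyclicElem (fun j => ι j = i) e m := by
  rw [cyclicRep, MonoidHom.comp_apply, map_zpow, FreeGroup.lift_apply_of, ← map_zpow,
    Units.coeHom_apply, MonoidHom.coe_toHomUnits, ← ofAdd_zsmul, smul_eq_mul, mul_one]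
  rfl

theorem exists_cyclicRep_sub_one_eq (g : FreeGroup α) :
    ∃ b, cyclicRep ι e hι g - 1 = (T 1 - 1 : ℚ[T;T⁻¹]) • b := by
  induction g using FreeGroup.induction_on with
  | C1 => exact ⟨0, by simp⟩
  | of i =>
    have := cyclicRep_of_zpow e hι i 1
    rw [zpow_one] at this
    rw [this]
    exact exists_cyclicElem_sub_one_eq _ _ _
  | inv_of i _ =>
    have := cyclicRep_of_zpow e hι i (-1)
    rw [_root_.zpow_neg_one] at this
    rw [this]
    exact exists_cyclicElem_sub_one_eq _ _ _
  | mul g h hg hh =>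
    obtain ⟨b, hb⟩ := hg
    obtain ⟨b', hb'⟩ := hh
    refine ⟨b * cyclicRep ι e hι h + b', ?_⟩
    rw [smul_add, ← smul_mul_assoc, ← hb, ← hb', map_mul, sub_mul, one_mul, sub_add_sub_cancel]

theorem exists_lift_cyclicRep_augProd_eq (l : List (FreeGroup α)) :
    ∃ b, MonoidAlgebra.lift ℚ _ _ (cyclicRep ι e hι) (augProd l) =
      (T 1 - 1 : ℚ[T;T⁻¹]) ^ l.length • b := by
  induction l with
  | nil => exact ⟨1, by simp [augProd]⟩
  | cons g l ih =>
    obtain ⟨b, hb⟩ := ih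
    obtain ⟨b', hb'⟩ := exists_cyclicRep_sub_one_eq e hι g
    refine ⟨b' * b, ?_⟩
    rw [augProd_cons, map_mul, hb, map_sub, map_one, MonoidAlgebra.lift_of, hb', smul_mul_smul_comm,
      List.length_cons, pow_succ']

theorem trace_coeff_mul_comm {R : Type*} [CommRing R] {m : Type*} [Fintype m] [DecidableEq m]
    (p q : Polynomial (Matrix m m R)) (k : ℕ) :
    ((p * q).coeff k).trace = ((q * p).coeff k).trace := by
  rw [Polynomial.coeff_mul, Polynomial.coeff_mul, trace_sum, trace_sum,
    ← Finset.Nat.sum_antidiagonal_swap]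
  exact Finset.sum_congr rfl fun x _ => trace_mul_comm _ _

/-- The class function extracted from the trace of `cyclicRep`. -/
noncomputable def cyclicFunctional (N : ℕ) : MonoidAlgebra ℚ (FreeGroup α) →ₗ[ℚ] ℚ :=
  choosePairing N (2 * N) ∘ₗ Matrix.traceLinearMap (ZMod r) ℚ ℚ[T;T⁻¹] ∘ₗ
    (Polynomial.lcoeff (Matrix (ZMod r) (ZMod r) ℚ[T;T⁻¹]) r).restrictScalars ℚ ∘ₗ
      (MonoidAlgebra.lift ℚ _ _ (cyclicRep ι e hι)).toLinearMap

theorem cyclicFunctional_apply (N : ℕ) (x : MonoidAlgebra ℚ (FreeGroup α)) :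
    cyclicFunctional e hι N x = choosePairing N (2 * N)
      ((MonoidAlgebra.lift ℚ _ _ (cyclicRep ι e hι) x).coeff r).trace :=
  rfl

theorem cyclicFunctional_of (N : ℕ) (g : FreeGroup α) :
    cyclicFunctional e hι N (MonoidAlgebra.of ℚ _ g) = choosePairing N (2 * N)
      ((cyclicRep ι e hι g).coeff r).trace := by
  rw [cyclicFunctional_apply, MonoidAlgebra.lift_of]

theorem cyclicFunctional_mem_polyClass (N : ℕ) :
    cyclicFunctional e hι N ∈ polyClass (FreeGroup α) (2 * N + 1) := by
  refine ⟨fun g h hgh => ?_, fun l hl => ?_⟩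
  · obtain ⟨u, rfl⟩ := isConj_iff.1 hgh
    rw [cyclicFunctional_of, cyclicFunctional_of, map_mul, trace_coeff_mul_comm, ← map_mul,
      inv_mul_cancel_left]
  · obtain ⟨b, hb⟩ := exists_lift_cyclicRep_augProd_eq e hι l
    rw [cyclicFunctional_apply, hb, hl, Polynomial.coeff_smul, trace_smul, smul_eq_mul,
      choosePairing_pow_mul]

/-- The element of the free group spelled by a list of syllables. -/
def syllableProd (L : List (α × ℤ)) : FreeGroup α :=
  (L.map fun p => FreeGroup.of p.1 ^ p.2).prod

theorem cyclicRep_syllableProd (L : List (α × ℤ)) : cyclicRep ι e hι (syllableProd L) =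
    (L.map fun p => cyclicElem (fun j => ι j = p.1) e p.2).prod := by
  simp only [syllableProd, map_list_prod, List.map_map]
  congr 2
  ext p : 1
  exact cyclicRep_of_zpow e hι _ _

theorem cyclicFunctional_eq_zero {N : ℕ} {L : List (α × ℤ)} (hL : L.length < r) :
    cyclicFunctional e hι N (MonoidAlgebra.of ℚ _ (syllableProd L)) = 0 := by
  rw [cyclicFunctional_of, cyclicRep_syllableProd, Polynomial.coeff_eq_zero_of_natDegree_lt,
    trace_zero, map_zero]
  refine (Polynomial.natDegree_list_prod_le _).trans_lt (lt_of_le_of_lt ?_ hL)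
  rw [List.map_map]
  refine (List.sum_le_card_nsmul _ 1 ?_).trans (by simp)
  simp only [List.mem_map, forall_exists_index, and_imp]
  rintro _ p _ rfl
  exact natDegree_cyclicElem_le _ _ _

theorem sum_add_natCast {M : Type*} [AddCommMonoid M] (f : ZMod r → M) (j : ZMod r) {k : ℕ}
    (hk : k = r) : ∑ i : Fin k, f (j + (i : ℕ)) = ∑ i, f i := by
  subst hk
  refine Function.Bijective.sum_comp ((Fintype.bijective_iff_injective_and_card _).2
    ⟨fun a b hab => ?_, by simp⟩) f
  have := (ZMod.natCast_eq_natCast_iff' _ _ _).1 (add_left_cancel hab)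
  rw [Nat.mod_eq_of_lt a.2, Nat.mod_eq_of_lt b.2] at this
  exact Fin.ext this

theorem cyclicFunctional_eq_sum {N : ℕ} (he : ∀ j, e j ≠ 0) (heN : ∑ j, e j ^ 2 = N)
    {L : List (α × ℤ)} (hL : L.length = r) (hLN : ∑ k : Fin L.length, L[k].2 ^ 2 ≤ (N : ℤ)) :
    cyclicFunctional e hι N (MonoidAlgebra.of ℚ _ (syllableProd L)) =
      ∑ j : ZMod r, if ∀ k : Fin L.length, (ι (j + (k : ℕ)), e (j + (k : ℕ))) = L[k]
        then 1 else 0 := by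
  have hcoeff : (cyclicRep ι e hι (syllableProd L)).coeff r = ((L.map fun p (j : ZMod r) =>
      if ι j = p.1 then (T (e j * p.2) - 1 : ℚ[T;T⁻¹]) else 0).map shiftMatrix).prod := by
    have h := Polynomial.coeff_list_prod_of_natDegree_le
      (L.map fun p => cyclicElem (fun j => ι j = p.1) e p.2) 1 (by
        simp only [List.mem_map, forall_exists_index, and_imp]
        rintro _ p _ rfl
        exact natDegree_cyclicElem_le _ _ _)
    rw [List.length_map, mul_one, hL] at h
    rw [cyclicRep_syllableProd, h, List.map_map, List.map_map]
    simp only [Function.comp_def, coeff_one_cyclicElem]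
  rw [cyclicFunctional_of, hcoeff, trace_shiftMatrix_list_prod _ (by simpa using hL), map_sum]
  refine Finset.sum_congr rfl fun j _ => ?_
  have hprod : (∏ k : Fin (L.map fun p (j : ZMod r) => if ι j = p.1 then
        (T (e j * p.2) - 1 : ℚ[T;T⁻¹]) else 0).length, (L.map fun p (j : ZMod r) => if ι j = p.1 then
        (T (e j * p.2) - 1 : ℚ[T;T⁻¹]) else 0)[k] (j + (k : ℕ))) =
      ∏ k : Fin L.length, if ι (j + (k : ℕ)) = L[k].1 then T (e (j + (k : ℕ)) * L[k].2) - 1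
        else 0 :=
    Fintype.prod_equiv (finCongr (List.length_map _)) _ _ fun k => by simp
  rw [hprod]
  simp only [Prod.ext_iff, forall_and]
  by_cases h : ∀ k : Fin L.length, ι (j + (k : ℕ)) = L[k].1
  · rw [Finset.prod_congr rfl fun k _ => if_pos (h k), choosePairing_prod_T_sub_one
      (fun k => he _) ((sum_add_natCast (fun i => e i ^ 2) j hL).trans heN) hLN]
    simp only [funext_iff, h, implies_true, true_and]
  · rw [if_neg fun h' => h h'.1]
    obtain ⟨k, hk⟩ := not_forall.1 h
    rw [Finset.prod_eq_zero (Finset.mem_univ k) (if_neg hk), map_zero]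

end CyclicFunctional

section Separation

/-- The linear extension of a homomorphism to `ℚ`. -/
noncomputable def homFunctional {G : Type*} [Group G] (χ : G →* Multiplicative ℚ) :
    MonoidAlgebra ℚ G →ₗ[ℚ] ℚ :=
  Finsupp.linearCombination ℚ (fun g => (χ g).toAdd) ∘ₗ
    (MonoidAlgebra.coeffLinearEquiv ℚ).toLinearMap

theorem homFunctional_of {G : Type*} [Group G] (χ : G →* Multiplicative ℚ) (g : G) :
    homFunctional χ (MonoidAlgebra.of ℚ G g) = (χ g).toAdd := by
  change Finsupp.linearCombination ℚ _ (Finsupp.single g (1 : ℚ)) = _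
  rw [Finsupp.linearCombination_single, one_smul]

theorem homFunctional_mem_polyClass {G : Type*} [Group G] (χ : G →* Multiplicative ℚ) :
    homFunctional χ ∈ polyClass G 2 := by
  refine ⟨fun g h hgh => ?_, fun l hl => ?_⟩
  · rw [homFunctional_of, homFunctional_of, isConj_iff_eq.1 (χ.map_isConj hgh)]
  · obtain ⟨g, h, rfl⟩ := List.length_eq_two.1 hl
    have : augProd [g, h] = MonoidAlgebra.of ℚ G (g * h) - MonoidAlgebra.of ℚ G g -
        MonoidAlgebra.of ℚ G h + MonoidAlgebra.of ℚ G 1 := by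
      simp only [augProd, List.map_cons, List.map_nil, List.prod_cons, List.prod_nil, map_mul,
        map_one]
      noncomm_ring
    rw [this, map_add, map_sub, map_sub, homFunctional_of, homFunctional_of, homFunctional_of,
      homFunctional_of, map_mul, map_one, toAdd_mul, toAdd_one]
    ring

variable {α : Type*}

theorem syllableProd_cons (p : α × ℤ) (L : List (α × ℤ)) :
    syllableProd (p :: L) = FreeGroup.of p.1 ^ p.2 * syllableProd L := by
  simp [syllableProd]

theorem syllableProd_append (L L' : List (α × ℤ)) :
    syllableProd (L ++ L') = syllableProd L * syllableProd L' := by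
  simp [syllableProd]

theorem exists_syllableProd_eq (g : FreeGroup α) : ∃ L, syllableProd L = g := by
  induction g using FreeGroup.induction_on with
  | C1 => exact ⟨[], rfl⟩
  | of i => exact ⟨[(i, 1)], by simp [syllableProd]⟩
  | inv_of i _ => exact ⟨[(i, -1)], by simp [syllableProd]⟩
  | mul g h hg hh =>
    obtain ⟨L, rfl⟩ := hg
    obtain ⟨L', rfl⟩ := hh
    exact ⟨L ++ L', syllableProd_append L L'⟩

theorem isConj_syllableProd_rotate (L : List (α × ℤ)) (k : ℕ) :
    IsConj (syllableProd L) (syllableProd (L.rotate k)) := by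
  induction k with
  | zero => rw [List.rotate_zero]
  | succ k ih =>
    refine ih.trans ?_
    rw [← List.rotate_rotate]
    cases L.rotate k with
    | nil => rw [List.rotate_nil]
    | cons p L =>
      rw [List.rotate_cons_succ, List.rotate_zero, syllableProd_append, syllableProd_cons,
        syllableProd_cons, isConj_iff]
      exact ⟨(FreeGroup.of p.1 ^ p.2)⁻¹, by simp [syllableProd]⟩

/-- No conjugate of the spelled element is spelled by fewer syllables. -/
def IsMinimalSpelling (L : List (α × ℤ)) : Prop :=
  ∀ L', IsConj (syllableProd L) (syllableProd L') → L.length ≤ L'.length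

theorem exists_isMinimalSpelling (c : FreeGroup α) :
    ∃ L, IsConj c (syllableProd L) ∧ IsMinimalSpelling L := by
  classical
  have h : ∃ m, ∃ L, IsConj c (syllableProd L) ∧ L.length = m := by
    obtain ⟨L, rfl⟩ := exists_syllableProd_eq c
    exact ⟨_, L, IsConj.refl _, rfl⟩
  obtain ⟨L, hL, hm⟩ := Nat.find_spec h
  refine ⟨L, hL, fun L' hL' => ?_⟩
  rw [hm]
  exact Nat.find_min' h ⟨L', hL.trans hL', rfl⟩

theorem IsMinimalSpelling.rotate {L : List (α × ℤ)} (hL : IsMinimalSpelling L) (k : ℕ) :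
    IsMinimalSpelling (L.rotate k) := fun L' hL' => by
  rw [List.length_rotate]
  exact hL L' ((isConj_syllableProd_rotate L k).trans hL')

theorem IsMinimalSpelling.snd_ne_zero_of_cons {p : α × ℤ} {L : List (α × ℤ)}
    (h : IsMinimalSpelling (p :: L)) : p.2 ≠ 0 := fun hp => by
  have := h L (by rw [syllableProd_cons, hp, zpow_zero, one_mul])
  simp at this

theorem IsMinimalSpelling.fst_ne_fst {L : List (α × ℤ)} (h : IsMinimalSpelling L)
    (hL : 2 ≤ L.length) : L[0].1 ≠ L[1].1 := by
  match L, hL with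
  | p :: q :: L, _ =>
    intro (hpq : p.1 = q.1)
    have := h ((p.1, p.2 + q.2) :: L) (by
      rw [syllableProd_cons, syllableProd_cons, syllableProd_cons, zpow_add, ← hpq, mul_assoc])
    simp at this

/-- The entry of a nonempty list at a cyclic index. -/
def cyclicGet {β : Type*} (L : List β) [NeZero L.length] (j : ZMod L.length) : β :=
  L[j.val]'(ZMod.val_lt j)

theorem cyclicGet_add {β : Type*} (L : List β) [NeZero L.length] (j : ZMod L.length) (k : ℕ)
    (hk : k < (L.rotate j.val).length) :
    cyclicGet L (j + k) = (L.rotate j.val)[k] := by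
  rw [List.getElem_rotate, cyclicGet]
  congr 1
  rw [ZMod.val_add, ZMod.val_natCast, Nat.add_mod_mod, add_comm]

theorem IsMinimalSpelling.cyclicGet_snd_ne_zero {L : List (α × ℤ)} (hL : IsMinimalSpelling L)
    [NeZero L.length] (j : ZMod L.length) : (cyclicGet L j).2 ≠ 0 := by
  have hpos : 0 < (L.rotate j.val).length := by
    rw [List.length_rotate]
    exact NeZero.pos _
  have h := cyclicGet_add L j 0 hpos
  rw [Nat.cast_zero, add_zero] at h
  rw [h]
  clear h
  have hrot := hL.rotate j.val
  revert hpos hrot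
  cases L.rotate j.val with
  | nil => simp
  | cons p L' => exact fun _ hrot => hrot.snd_ne_zero_of_cons

theorem IsMinimalSpelling.cyclicGet_fst_ne {L : List (α × ℤ)} (hL : IsMinimalSpelling L)
    [NeZero L.length] (h2 : 2 ≤ L.length) (j : ZMod L.length) :
    (cyclicGet L j).1 ≠ (cyclicGet L (j + 1)).1 := by
  have hlen : 2 ≤ (L.rotate j.val).length := by rwa [List.length_rotate]
  have h0 := cyclicGet_add L j 0 (by omega)
  have h1 := cyclicGet_add L j 1 (by omega)
  rw [Nat.cast_zero, add_zero] at h0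
  rw [Nat.cast_one] at h1
  rw [h0, h1]
  exact (hL.rotate j.val).fst_ne_fst hlen

theorem eq_rotate_of_forall_cyclicGet {β : Type*} {L L' : List β} [NeZero L.length]
    (hlen : L'.length = L.length) (j : ZMod L.length)
    (h : ∀ k : Fin L'.length, cyclicGet L (j + (k : ℕ)) = L'[k]) : L' = L.rotate j.val := by
  refine List.ext_getElem (by rw [List.length_rotate, hlen]) fun k hk hk' => ?_
  rw [← cyclicGet_add L j k hk']
  exact (h ⟨k, hk⟩).symm

/-- The sum of the squares of the exponents. -/
def exponentEnergy (L : List (α × ℤ)) : ℕ :=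
  ∑ k : Fin L.length, L[k].2.natAbs ^ 2

theorem cast_exponentEnergy (L : List (α × ℤ)) :
    (exponentEnergy L : ℤ) = ∑ k : Fin L.length, L[k].2 ^ 2 := by
  simp [exponentEnergy]

theorem sum_cyclicGet_sq (L : List (α × ℤ)) [NeZero L.length] :
    ∑ j, (cyclicGet L j).2 ^ 2 = (exponentEnergy L : ℤ) := by
  rw [cast_exponentEnergy, ← sum_add_natCast (fun j => (cyclicGet L j).2 ^ 2) 0 rfl]
  refine Finset.sum_congr rfl fun k _ => ?_
  rw [zero_add, cyclicGet]
  congr 2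
  simp [ZMod.val_natCast, Nat.mod_eq_of_lt k.2]

variable [DecidableEq α]

/-- The exponent sum of a generator, with rational values. -/
def exponentSum (i : α) : FreeGroup α →* Multiplicative ℚ :=
  FreeGroup.lift fun i' => Multiplicative.ofAdd (if i' = i then 1 else 0)

theorem exponentSum_of_zpow (i i' : α) (m : ℤ) :
    (exponentSum i (FreeGroup.of i' ^ m)).toAdd = if i' = i then (m : ℚ) else 0 := by
  rw [map_zpow, exponentSum, FreeGroup.lift_apply_of, toAdd_zpow, toAdd_ofAdd, smul_ite, smul_zero,
    zsmul_one]

theorem isConj_syllableProd_of_length_le {L L' : List (α × ℤ)} (hL : IsMinimalSpelling L)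
    (hlt : L'.length < L.length ∨
      L'.length = L.length ∧ exponentEnergy L' ≤ exponentEnergy L)
    (h : ∀ d, 1 ≤ d → ∀ f ∈ polyClass (FreeGroup α) d,
      f (MonoidAlgebra.of ℚ _ (syllableProd L)) = f (MonoidAlgebra.of ℚ _ (syllableProd L'))) :
    IsConj (syllableProd L) (syllableProd L') := by
  have hle : L'.length ≤ L.length := hlt.elim le_of_lt fun h => h.1.le
  rcases lt_trichotomy L.length 1 with h0 | h1 | h2
  · rw [List.eq_nil_of_length_eq_zero (show L.length = 0 by omega),
      List.eq_nil_of_length_eq_zero (show L'.length = 0 by omega)]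
  · obtain ⟨⟨i, m⟩, rfl⟩ := List.length_eq_one_iff.1 h1
    have hm : m ≠ 0 := hL.snd_ne_zero_of_cons
    have hf := h 2 one_le_two _ (homFunctional_mem_polyClass (exponentSum i))
    rw [homFunctional_of, homFunctional_of, syllableProd_cons, syllableProd, List.map_nil,
      List.prod_nil, mul_one, exponentSum_of_zpow, if_pos rfl] at hf
    rcases L' with _ | ⟨⟨i', m'⟩, _ | ⟨q, L'⟩⟩
    · rw [syllableProd, List.map_nil, List.prod_nil, map_one, toAdd_one] at hf
      exact absurd (by exact_mod_cast hf) hm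
    · rw [syllableProd_cons, syllableProd, List.map_nil, List.prod_nil, mul_one,
        exponentSum_of_zpow] at hf
      split_ifs at hf with hi
      · rw [show i' = i from hi, show m = m' by exact_mod_cast hf]
      · exact absurd (by exact_mod_cast hf) hm
    · simp at hle
  · have : NeZero L.length := ⟨by omega⟩
    have hι := hL.cyclicGet_fst_ne h2
    let N := exponentEnergy L
    have hf := h (2 * N + 1) (by omega) _
      (cyclicFunctional_mem_polyClass (fun j => (cyclicGet L j).2) hι N)
    have hsum {M : List (α × ℤ)} (hM : M.length = L.length)
        (hMN : exponentEnergy M ≤ exponentEnergy L) :=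
      cyclicFunctional_eq_sum (fun j => (cyclicGet L j).2) hι hL.cyclicGet_snd_ne_zero
        (sum_cyclicGet_sq L) hM (by rw [← cast_exponentEnergy]; exact_mod_cast hMN)
    have hpos : 0 < cyclicFunctional (fun j => (cyclicGet L j).2) hι N
        (MonoidAlgebra.of ℚ _ (syllableProd L)) := by
      rw [hsum rfl le_rfl]
      refine Finset.sum_pos' (fun j _ => by split_ifs <;> norm_num) ⟨0, Finset.mem_univ _, ?_⟩
      rw [if_pos fun k => ?_]
      · exact one_pos
      · simp [cyclicGet, ZMod.val_natCast, Nat.mod_eq_of_lt k.2]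
    rw [hf] at hpos
    rcases hlt with hlt | ⟨hlen, hN⟩
    · rw [cyclicFunctional_eq_zero _ _ hlt] at hpos
      exact absurd hpos (lt_irrefl _)
    · rw [hsum hlen hN] at hpos
      obtain ⟨j, -, hj⟩ := Finset.exists_ne_zero_of_sum_ne_zero hpos.ne'
      rw [eq_rotate_of_forall_cyclicGet hlen j (by simpa using hj)]
      exact isConj_syllableProd_rotate L _

/-- Polynomial class functions separate the conjugacy classes of a free group. -/
theorem isConj_of_forall_polyClass {c d : FreeGroup α}
    (h : ∀ m, 1 ≤ m → ∀ f ∈ polyClass (FreeGroup α) m,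
      f (MonoidAlgebra.of ℚ _ c) = f (MonoidAlgebra.of ℚ _ d)) : IsConj c d := by
  obtain ⟨L, hcL, hL⟩ := exists_isMinimalSpelling c
  obtain ⟨L', hdL', hL'⟩ := exists_isMinimalSpelling d
  have h' (m : ℕ) (hm : 1 ≤ m) (f) (hf : f ∈ polyClass (FreeGroup α) m) :
      f (MonoidAlgebra.of ℚ _ (syllableProd L)) = f (MonoidAlgebra.of ℚ _ (syllableProd L')) := by
    rw [← hf.1 _ _ hcL, ← hf.1 _ _ hdL', h m hm f hf]
  refine hcL.trans (IsConj.trans ?_ hdL'.symm)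
  by_cases hlt : L'.length < L.length ∨
      L'.length = L.length ∧ exponentEnergy L' ≤ exponentEnergy L
  · exact isConj_syllableProd_of_length_le hL hlt h'
  · exact (isConj_syllableProd_of_length_le hL' (by omega)
      fun m hm f hf => (h' m hm f hf).symm).symm

end Separation

/-- Periodicity of the unoriented conjugacy class of `c` under an element of
`IA_n(ℤ/3)` forces the oriented conjugacy class of `c` to be fixed
(the strengthening of Theorem 4.1 established in Step 3 of its proof). -/
theorem unoriented_periodic_conjClass_fixed {n : ℕ} (hn : 1 ≤ n)
    (Φ : FreeGroup (Fin n) ≃* FreeGroup (Fin n))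
    (hΦ : ActsTriviallyOnH1Mod3 Φ)
    (c : FreeGroup (Fin n)) (k : ℕ) (hk : 1 ≤ k)
    (hper : IsConj ((Φ ^ k) c) c ∨ IsConj ((Φ ^ k) c) c⁻¹) :
    IsConj (Φ c) c := by
  have hperiod : ∃ K, 0 < K ∧ IsConj ((Φ ^ K) c) c := by
    rcases hper with h | h
    · exact ⟨k, hk, h⟩
    · refine ⟨k + k, by omega, ?_⟩
      have h1 := (Φ ^ k : FreeGroup (Fin n) ≃* FreeGroup (Fin n)).toMonoidHom.map_isConj h
      obtain ⟨u, hu⟩ := isConj_iff.1 h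
      have h2 : IsConj ((Φ ^ k) c)⁻¹ c :=
        isConj_iff.2 ⟨u, by rw [← inv_inj, ← hu]; group⟩
      rw [pow_add, MulAut.mul_apply]
      refine h1.trans ?_
      change IsConj ((Φ ^ k) c⁻¹) c
      rwa [map_inv]
  obtain ⟨K, hK, hKc⟩ := hperiod
  refine isConj_of_forall_polyClass fun m hm f hf => ?_
  have := hΦ.polyClass_apply_orbit_succ hK hKc hm hf 0
  simpa [fwdDiff, orbitSeq, sub_eq_zero] using this
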